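/- arXiv:1706.00851 — 3 statements merged into one kernel-verified Lean document; each statement's English description precedes it below -/
import Mathlib

section
/- Let d ≥ 2 and let G be a finite simple d-regular graph. For every k ≥ 3: if k is odd then N_k = M_k − (d−2)(M_{k−2} + M_{k−4} + … + M_3 + M_1), and if k is even then N_k = M_k − (d−2)(M_{k−2} + M_{k−4} + … + M_4 + M_2). -/
variable {V : Type*}

/-- `f : Fin (k+1) → V` is a walk of length `k` in `G`: consecutive vertices are adjacent. -/
def IsWalkFun (G : SimpleGraph V) (k : ℕ) (f : Fin (k + 1) → V) : Prop :=
  ∀ i : ℕ, ∀ h : i < k, G.Adj (f ⟨i, by omega⟩) (f ⟨i + 1, by omega⟩)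

/-- The walk is non-backtracking: `v_{i-1} ≠ v_{i+1}` for `1 ≤ i ≤ k-1`. -/
def IsNonBacktracking (k : ℕ) (f : Fin (k + 1) → V) : Prop :=
  ∀ i : ℕ, 1 ≤ i → ∀ h : i < k, f ⟨i - 1, by omega⟩ ≠ f ⟨i + 1, by omega⟩

/-- A closed non-backtracking walk of length `k` (possibly with a "tail", i.e. no
condition relating `v_1` and `v_{k-1}`). -/
def IsClosedNBWalk (G : SimpleGraph V) (k : ℕ) (f : Fin (k + 1) → V) : Prop :=
  IsWalkFun G k f ∧ IsNonBacktracking k f ∧ f (Fin.last k) = f 0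

/-- A rooted non-backtracking cycle of length `k`: a closed non-backtracking walk
with the extra condition `v_1 ≠ v_{k-1}`. -/
def IsNBCycle (G : SimpleGraph V) (k : ℕ) (f : Fin (k + 1) → V) : Prop :=
  IsClosedNBWalk G k f ∧ f ⟨1 % (k + 1), Nat.mod_lt 1 k.succ_pos⟩ ≠ f ⟨k - 1, by omega⟩

/-- `N_k`: the number of rooted non-backtracking cycles of length `k` in `G`. -/
noncomputable def nbCycleCount (G : SimpleGraph V) (k : ℕ) : ℕ :=
  Nat.card { f : Fin (k + 1) → V // IsNBCycle G k f }

/-- `M_k`: the number of closed non-backtracking walks of length `k` in `G`. -/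
noncomputable def closedNBWalkCount (G : SimpleGraph V) (k : ℕ) : ℕ :=
  Nat.card { f : Fin (k + 1) → V // IsClosedNBWalk G k f }

/-- A closed non-backtracking walk with a tail: `v_1 = v_{k-1}`. -/
def IsTailedNBWalk (G : SimpleGraph V) (k : ℕ) (f : Fin (k + 1) → V) : Prop :=
  IsClosedNBWalk G k f ∧ f ⟨1 % (k + 1), Nat.mod_lt 1 k.succ_pos⟩ = f ⟨k - 1, by omega⟩

/-- The number of closed non-backtracking walks of length `k` with a tail. -/
noncomputable def tailedNBWalkCount (G : SimpleGraph V) (k : ℕ) : ℕ :=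
  Nat.card { f : Fin (k + 1) → V // IsTailedNBWalk G k f }

theorem closedNBWalkCount_eq_add [Finite V] (G : SimpleGraph V) (k : ℕ) :
    closedNBWalkCount G k = nbCycleCount G k + tailedNBWalkCount G k := by
  classical
  have := Fintype.ofFinite V
  simp only [closedNBWalkCount, nbCycleCount, tailedNBWalkCount, Nat.card_eq_fintype_card,
    Fintype.card_subtype, IsNBCycle, IsTailedNBWalk]
  rw [← Finset.filter_filter, ← Finset.filter_filter]
  exact (Finset.card_filter_add_card_filter_not _).symm.trans (add_comm _ _)

theorem not_isClosedNBWalk_one {G : SimpleGraph V} {f : Fin 2 → V} :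
    ¬ IsClosedNBWalk G 1 f := fun ⟨hw, _, hc⟩ =>
  G.ne_of_adj (hw 0 one_pos) hc.symm

theorem not_isClosedNBWalk_two {G : SimpleGraph V} {f : Fin 3 → V} :
    ¬ IsClosedNBWalk G 2 f := fun ⟨_, hb, hc⟩ =>
  hb 1 le_rfl one_lt_two hc.symm

theorem tailedNBWalkCount_one (G : SimpleGraph V) : tailedNBWalkCount G 1 = 0 := by
  have : IsEmpty { f : Fin (1 + 1) → V // IsTailedNBWalk G 1 f } :=
    ⟨fun f => not_isClosedNBWalk_one f.2.1⟩
  exact Nat.card_of_isEmpty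

theorem tailedNBWalkCount_two (G : SimpleGraph V) : tailedNBWalkCount G 2 = 0 := by
  have : IsEmpty { f : Fin (2 + 1) → V // IsTailedNBWalk G 2 f } :=
    ⟨fun f => not_isClosedNBWalk_two f.2.1⟩
  exact Nat.card_of_isEmpty

/-- Attach a tail with endpoint `u` to a closed walk `g`. -/
def attachTail (k : ℕ) (g : Fin (k + 1) → V) (u : V) (i : Fin (k + 2 + 1)) : V :=
  if h : 1 ≤ i.1 ∧ i.1 ≤ k + 1 then g ⟨i.1 - 1, by omega⟩ else u

theorem attachTail_succ (k : ℕ) (g : Fin (k + 1) → V) (u : V) (i : ℕ) (hi : i < k + 1) :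
    attachTail k g u ⟨i + 1, by omega⟩ = g ⟨i, hi⟩ := by
  have h : 1 ≤ i + 1 ∧ i + 1 ≤ k + 1 := by omega
  simp [attachTail, h]

theorem attachTail_zero (k : ℕ) (g : Fin (k + 1) → V) (u : V) (h : 0 < k + 2 + 1) :
    attachTail k g u ⟨0, h⟩ = u := by
  simp [attachTail]

theorem attachTail_last (k : ℕ) (g : Fin (k + 1) → V) (u : V) (h : k + 2 < k + 2 + 1) :
    attachTail k g u ⟨k + 2, h⟩ = u := by
  simp [attachTail]

theorem isTailedNBWalk_attachTail {G : SimpleGraph V} {k : ℕ} (hk : 1 ≤ k)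
    {g : Fin (k + 1) → V} (hg : IsClosedNBWalk G k g) {u : V} (hu : G.Adj (g 0) u)
    (h1 : u ≠ g ⟨1 % (k + 1), Nat.mod_lt 1 k.succ_pos⟩) (h2 : u ≠ g ⟨k - 1, by omega⟩) :
    IsTailedNBWalk G (k + 2) (attachTail k g u) := by
  obtain ⟨hw, hb, hc⟩ := hg
  have e1 : 1 % (k + 1) = 1 := Nat.mod_eq_of_lt (by omega)
  simp only [e1] at h1
  have hc' : g ⟨k, by omega⟩ = g 0 := hc
  refine ⟨⟨fun i hi => ?_, fun i h1i hi => ?_, ?_⟩, ?_⟩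
  · rcases Nat.eq_zero_or_pos i with rfl | hpos
    · rw [attachTail_zero, attachTail_succ _ _ _ 0 (by omega)]
      exact hu.symm
    · obtain ⟨i, rfl⟩ := Nat.exists_eq_add_of_le' hpos
      rw [attachTail_succ _ _ _ i (by omega)]
      rcases Nat.lt_or_ge i k with h | h
      · rw [attachTail_succ _ _ _ (i + 1) (by omega)]
        exact hw i h
      · obtain rfl : i = k := by omega
        rw [attachTail_last, hc']
        exact hu
  · obtain ⟨i, rfl⟩ := Nat.exists_eq_add_of_le' h1i
    simp only [Nat.add_sub_cancel]
    rcases Nat.eq_zero_or_pos i with rfl | hpos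
    · rw [attachTail_zero, attachTail_succ _ _ _ 1 (by omega)]
      exact h1
    · obtain ⟨i, rfl⟩ := Nat.exists_eq_add_of_le' hpos
      rw [attachTail_succ _ _ _ i (by omega)]
      rcases Nat.lt_or_ge (i + 1) k with h | h
      · rw [attachTail_succ _ _ _ (i + 2) (by omega)]
        exact hb (i + 1) (by omega) h
      · obtain rfl : k = i + 1 := by omega
        rw [attachTail_last]
        exact h2.symm
  · exact (attachTail_last _ _ _ _).trans (attachTail_zero _ _ _ _).symm
  · have e2 : 1 % (k + 2 + 1) = 0 + 1 := Nat.mod_eq_of_lt (by omega)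
    simp only [e2]
    rw [attachTail_succ _ _ _ 0 (by omega)]
    exact hc'.symm.trans (attachTail_succ _ _ _ k (by omega)).symm

/-- Remove the tail from a walk. -/
def removeTail (k : ℕ) (f : Fin (k + 2 + 1) → V) (i : Fin (k + 1)) : V :=
  f ⟨i.1 + 1, by omega⟩

theorem isClosedNBWalk_removeTail {G : SimpleGraph V} {k : ℕ} {f : Fin (k + 2 + 1) → V}
    (hf : IsTailedNBWalk G (k + 2) f) : IsClosedNBWalk G k (removeTail k f) := by
  obtain ⟨⟨hw, hb, -⟩, ht⟩ := hf
  refine ⟨fun i hi => hw (i + 1) (by omega), fun i h1i hi => ?_, ?_⟩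
  · obtain ⟨i, rfl⟩ := Nat.exists_eq_add_of_le' h1i
    exact hb (i + 2) (by omega) (by omega)
  · have e2 : 1 % (k + 2 + 1) = 1 := Nat.mod_eq_of_lt (by omega)
    simp only [e2] at ht
    exact ht.symm

/-- The possible endpoints of a tail attached to a closed walk `g`. -/
def IsTailEnd (G : SimpleGraph V) (k : ℕ) (g : Fin (k + 1) → V) (u : V) : Prop :=
  G.Adj (g 0) u ∧ u ≠ g ⟨1 % (k + 1), Nat.mod_lt 1 k.succ_pos⟩ ∧ u ≠ g ⟨k - 1, by omega⟩

theorem isTailEnd_removeTail {G : SimpleGraph V} {k : ℕ} (hk : 1 ≤ k)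
    {f : Fin (k + 2 + 1) → V} (hf : IsTailedNBWalk G (k + 2) f) :
    IsTailEnd G k (removeTail k f) (f 0) := by
  obtain ⟨⟨hw, hb, hc⟩, -⟩ := hf
  have e1 : 1 % (k + 1) = 1 := Nat.mod_eq_of_lt (by omega)
  refine ⟨(hw 0 (by omega)).symm, ?_, ?_⟩
  · simp only [e1]
    exact hb 1 le_rfl (by omega)
  · obtain ⟨k, rfl⟩ := Nat.exists_eq_add_of_le' hk
    rw [← hc]
    exact (hb (k + 2) (by omega) (by omega)).symm

/-- A tailed walk is a closed walk together with the endpoint of its tail. -/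
def tailedNBWalkEquiv (G : SimpleGraph V) {k : ℕ} (hk : 1 ≤ k) :
    { f : Fin (k + 2 + 1) → V // IsTailedNBWalk G (k + 2) f } ≃
      Σ g : { g : Fin (k + 1) → V // IsClosedNBWalk G k g }, { u : V // IsTailEnd G k g u } where
  toFun f := ⟨⟨removeTail k f, isClosedNBWalk_removeTail f.2⟩, ⟨f.1 0, isTailEnd_removeTail hk f.2⟩⟩
  invFun p := ⟨attachTail k p.1 p.2,
    isTailedNBWalk_attachTail hk p.1.2 p.2.2.1 p.2.2.2.1 p.2.2.2.2⟩
  left_inv := by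
    rintro ⟨f, hf⟩
    ext ⟨i, hi⟩
    change attachTail k (removeTail k f) (f 0) ⟨i, hi⟩ = f ⟨i, hi⟩
    rcases Nat.eq_zero_or_pos i with rfl | hpos
    · exact attachTail_zero _ _ _ _
    · obtain ⟨i, rfl⟩ := Nat.exists_eq_add_of_le' hpos
      rcases Nat.lt_or_ge i (k + 1) with h | h
      · rw [attachTail_succ _ _ _ i h]
        rfl
      · obtain rfl : i = k + 1 := by omega
        exact (attachTail_last _ _ _ _).trans hf.1.2.2.symm
  right_inv := by
    rintro ⟨⟨g, hg⟩, ⟨u, hu⟩⟩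
    have h1 : removeTail k (attachTail k g u) = g :=
      funext fun i => attachTail_succ k g u i.1 i.2
    have h2 : attachTail k g u 0 = u := attachTail_zero _ _ _ _
    refine Sigma.subtype_ext (Subtype.ext h1) h2

theorem card_isTailEnd [Fintype V] [DecidableEq V] {G : SimpleGraph V} [DecidableRel G.Adj]
    {d : ℕ} (hd : 2 ≤ d) (hreg : G.IsRegularOfDegree d) {k : ℕ} (hk : 1 ≤ k)
    {g : Fin (k + 1) → V} (hg : IsClosedNBWalk G k g) :
    Nat.card { u : V // IsTailEnd G k g u } = (d - 2) +
      if g ⟨1 % (k + 1), Nat.mod_lt 1 k.succ_pos⟩ = g ⟨k - 1, by omega⟩ then 1 else 0 := by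
  obtain ⟨hw, -, hc⟩ := hg
  have e1 : 1 % (k + 1) = 1 := Nat.mod_eq_of_lt (by omega)
  have ha : g ⟨1 % (k + 1), Nat.mod_lt 1 k.succ_pos⟩ ∈ G.neighborFinset (g 0) := by
    simp only [e1, SimpleGraph.mem_neighborFinset]
    exact hw 0 (by omega)
  have hb : g ⟨k - 1, by omega⟩ ∈ G.neighborFinset (g 0) := by
    rw [SimpleGraph.mem_neighborFinset, ← hc]
    obtain ⟨k, rfl⟩ := Nat.exists_eq_add_of_le' hk
    exact (hw k (by omega)).symm
  have hdeg : (G.neighborFinset (g 0)).card = d := hreg (g 0)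
  unfold IsTailEnd
  generalize g ⟨1 % (k + 1), _⟩ = a at *
  generalize g ⟨k - 1, _⟩ = b at *
  have hset : Nat.card { u : V // G.Adj (g 0) u ∧ u ≠ a ∧ u ≠ b } =
      (((G.neighborFinset (g 0)).erase a).erase b).card := by
    rw [Nat.card_eq_fintype_card]
    refine Fintype.card_of_subtype _ fun u => ?_
    simp only [Finset.mem_erase, SimpleGraph.mem_neighborFinset]
    tauto
  rw [hset]
  split_ifs with hab
  · subst hab
    rw [Finset.erase_idem, Finset.card_erase_of_mem ha, hdeg]
    omega
  · rw [Finset.card_erase_of_mem (Finset.mem_erase.2 ⟨Ne.symm hab, hb⟩),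
      Finset.card_erase_of_mem ha, hdeg]
    omega

theorem tailedNBWalkCount_add_two [Fintype V] {G : SimpleGraph V} [DecidableRel G.Adj]
    {d : ℕ} (hd : 2 ≤ d) (hreg : G.IsRegularOfDegree d) {k : ℕ} (hk : 1 ≤ k) :
    tailedNBWalkCount G (k + 2) =
      (d - 2) * closedNBWalkCount G k + tailedNBWalkCount G k := by
  classical
  rw [tailedNBWalkCount, Nat.card_congr (tailedNBWalkEquiv G hk), Nat.card_sigma,
    Finset.sum_congr rfl fun g _ => card_isTailEnd hd hreg hk g.2, Finset.sum_add_distrib]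
  congr 1
  · simp [closedNBWalkCount, Nat.card_eq_fintype_card, mul_comm]
  · rw [← Finset.card_filter, ← Fintype.card_subtype, ← Nat.card_eq_fintype_card]
    exact Nat.card_congr (Equiv.subtypeSubtypeEquivSubtypeInter (IsClosedNBWalk G k)
      fun g => g ⟨1 % (k + 1), Nat.mod_lt 1 k.succ_pos⟩ = g ⟨k - 1, by omega⟩)

theorem tailedNBWalkCount_eq_sum [Fintype V] {G : SimpleGraph V} [DecidableRel G.Adj]
    {d : ℕ} (hd : 2 ≤ d) (hreg : G.IsRegularOfDegree d) {r : ℕ} (hr : 1 ≤ r)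
    (h0 : tailedNBWalkCount G r = 0) (m : ℕ) :
    tailedNBWalkCount G (r + 2 * m) =
      (d - 2) * ∑ i ∈ Finset.range m, closedNBWalkCount G (r + 2 * i) := by
  induction m with
  | zero => simpa using h0
  | succ m ih =>
    rw [Finset.sum_range_succ, mul_add (d - 2), ← ih, mul_add, ← add_assoc, mul_one,
      tailedNBWalkCount_add_two hd hreg (by omega), add_comm]

theorem nbCycleCount_eq_sub_sum [Fintype V] {G : SimpleGraph V} [DecidableRel G.Adj]
    {d : ℕ} (hd : 2 ≤ d) (hreg : G.IsRegularOfDegree d) {r : ℕ} (hr : 1 ≤ r)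
    (h0 : tailedNBWalkCount G r = 0) (m : ℕ) :
    (nbCycleCount G (r + 2 * m) : ℤ) = closedNBWalkCount G (r + 2 * m) -
      ((d : ℤ) - 2) *
        ∑ j ∈ Finset.Icc 1 m, (closedNBWalkCount G (r + 2 * m - 2 * j) : ℤ) := by
  have hs : ∑ j ∈ Finset.Icc 1 m, (closedNBWalkCount G (r + 2 * m - 2 * j) : ℤ) =
      ∑ i ∈ Finset.range m, (closedNBWalkCount G (r + 2 * i) : ℤ) := by
    refine Finset.sum_nbij' (fun j => m - j) (fun i => m - i) ?_ ?_ ?_ ?_ ?_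
    · intro j hj; simp only [Finset.mem_Icc, Finset.mem_range] at *; omega
    · intro j hj; simp only [Finset.mem_Icc, Finset.mem_range] at *; omega
    · intro j hj; simp only [Finset.mem_Icc] at *; omega
    · intro j hj; simp only [Finset.mem_range] at *; omega
    · intro j hj
      rw [Finset.mem_Icc] at hj
      congr 2
      omega
  rw [hs, closedNBWalkCount_eq_add G (r + 2 * m), tailedNBWalkCount_eq_sum hd hreg hr h0]
  push_cast [Nat.cast_sub hd]
  ring

theorem nbCycle_count_eq_alternating_sum (G : SimpleGraph V) [Fintype V]
    [DecidableRel G.Adj] (d : ℕ) (hd : 2 ≤ d) (hreg : G.IsRegularOfDegree d)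
    (k : ℕ) (hk : 3 ≤ k) :
    (Odd k →
      (nbCycleCount G k : ℤ) = closedNBWalkCount G k -
        ((d : ℤ) - 2) * ∑ j ∈ Finset.Icc 1 ((k - 1) / 2), (closedNBWalkCount G (k - 2 * j) : ℤ)) ∧
    (Even k →
      (nbCycleCount G k : ℤ) = closedNBWalkCount G k -
        ((d : ℤ) - 2) * ∑ j ∈ Finset.Icc 1 (k / 2 - 1), (closedNBWalkCount G (k - 2 * j) : ℤ)) := by
  constructor
  · rintro ⟨m, rfl⟩
    rw [Nat.add_sub_cancel, Nat.mul_div_cancel_left m two_pos, add_comm (2 * m) 1]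
    exact nbCycleCount_eq_sub_sum hd hreg le_rfl (tailedNBWalkCount_one G) m
  · intro he
    obtain ⟨m, rfl⟩ : ∃ m, k = 2 + 2 * m := by
      obtain ⟨m, rfl⟩ := he
      exact ⟨m - 1, by omega⟩
    rw [show (2 + 2 * m) / 2 - 1 = m by omega]
    exact nbCycleCount_eq_sub_sum hd hreg one_le_two (tailedNBWalkCount_two G) m
end

section
/- Let d ≥ 2 and let G be a finite simple d-regular graph with adjacency matrix A, regarded as a real matrix. For every k ≥ 2, A_k = (√(d−1))^k · U_k( A/(2√(d−1)) ) − (√(d−1))^{k−2} · U_{k−2}( A/(2√(d−1)) ), where the Chebyshev polynomials are evaluated at the matrix A/(2√(d−1)). -/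
variable {V : Type*}

/-- `A_k`: the integer matrix whose `(v, w)` entry is the number of non-backtracking
walks of length `k` in `G` from `v` to `w`. -/
noncomputable def nbWalkMatrix (G : SimpleGraph V) [Fintype V] (k : ℕ) : Matrix V V ℤ :=
  Matrix.of fun v w =>
    (Nat.card { f : Fin (k + 1) → V //
      IsWalkFun G k f ∧ IsNonBacktracking k f ∧ f 0 = v ∧ f (Fin.last k) = w } : ℤ)

/-- `A_k` regarded as a real matrix. -/
noncomputable def nbWalkMatrixR (G : SimpleGraph V) [Fintype V] (k : ℕ) : Matrix V V ℝ :=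
  Matrix.of fun v w =>
    (Nat.card { f : Fin (k + 1) → V //
      IsWalkFun G k f ∧ IsNonBacktracking k f ∧ f 0 = v ∧ f (Fin.last k) = w } : ℝ)

/-- The number of non-backtracking walks of length `k + 1` from `a` to `w` with first step
from `a` to `b`. -/
noncomputable def nbWalkCountFrom (G : SimpleGraph V) (k : ℕ) (a b w : V) : ℕ :=
  Nat.card { f : Fin (k + 2) → V // (IsWalkFun G (k + 1) f ∧ IsNonBacktracking (k + 1) f ∧
    f 0 = a ∧ f (Fin.last (k + 1)) = w) ∧ f 1 = b }

theorem isWalkFun_cons (G : SimpleGraph V) (k : ℕ) (a : V) (g : Fin (k + 1) → V) :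
    IsWalkFun G (k + 1) (Fin.cons a g : Fin (k + 2) → V) ↔ G.Adj a (g 0) ∧ IsWalkFun G k g := by
  constructor
  · intro h
    exact ⟨h 0 k.succ_pos, fun i hi => h (i + 1) (by omega)⟩
  · rintro ⟨h0, h⟩ i hi
    cases i with
    | zero => exact h0
    | succ i => exact h i (by omega)

theorem isNonBacktracking_cons (k : ℕ) (a : V) (g : Fin (k + 2) → V) :
    IsNonBacktracking (k + 2) (Fin.cons a g : Fin (k + 3) → V) ↔
      g 1 ≠ a ∧ IsNonBacktracking (k + 1) g := by
  constructor
  · intro h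
    refine ⟨(h 1 le_rfl (Nat.one_lt_succ_succ k)).symm, fun i hi hik => ?_⟩
    obtain ⟨i, rfl⟩ := Nat.exists_eq_add_of_le' hi
    exact h (i + 2) (by omega) (by omega)
  · rintro ⟨h0, h⟩ i hi hik
    obtain ⟨i, rfl⟩ := Nat.exists_eq_add_of_le' hi
    cases i with
    | zero => exact h0.symm
    | succ i => exact h (i + 1) (by omega) (by omega)

theorem nbWalkMatrixR_succ_apply (G : SimpleGraph V) [Fintype V] (k : ℕ) (a w : V) :
    nbWalkMatrixR G (k + 1) a w = ∑ b, (nbWalkCountFrom G k a b w : ℝ) := by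
  classical
  simp only [nbWalkMatrixR, nbWalkCountFrom, Matrix.of_apply, Nat.card_eq_fintype_card,
    Fintype.card_subtype, ← Finset.filter_filter]
  rw [← Nat.cast_sum, Nat.cast_inj]
  exact Finset.card_eq_sum_card_fiberwise fun _ _ => Finset.mem_coe.2 (Finset.mem_univ _)

theorem nbWalkCountFrom_of_not_adj (G : SimpleGraph V) (k : ℕ) {a b : V} (w : V)
    (h : ¬ G.Adj a b) : nbWalkCountFrom G k a b w = 0 := by
  have : IsEmpty { f : Fin (k + 2) → V // (IsWalkFun G (k + 1) f ∧
      IsNonBacktracking (k + 1) f ∧ f 0 = a ∧ f (Fin.last (k + 1)) = w) ∧ f 1 = b } := by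
    refine ⟨fun ⟨f, ⟨hf, _, h0, _⟩, h1⟩ => h ?_⟩
    rw [← h0, ← h1]
    exact hf 0 (by omega)
  exact Nat.card_of_isEmpty

theorem nbWalkCountFrom_zero (G : SimpleGraph V) [DecidableEq V] {a b : V} (w : V)
    (h : G.Adj a b) : nbWalkCountFrom G 0 a b w = if b = w then 1 else 0 := by
  split_ifs with hw
  · refine Nat.card_eq_one_iff_exists.2 ⟨⟨![a, b], ⟨?_, ?_, rfl, hw⟩, rfl⟩, ?_⟩
    · intro i hi
      obtain rfl : i = 0 := by omega
      exact h
    · intro i h1 h2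
      omega
    · rintro ⟨f, ⟨_, _, h0, _⟩, h1⟩
      refine Subtype.ext (funext fun i => ?_)
      fin_cases i
      · exact h0
      · exact h1
  · have : IsEmpty { f : Fin (0 + 2) → V // (IsWalkFun G (0 + 1) f ∧
        IsNonBacktracking (0 + 1) f ∧ f 0 = a ∧ f (Fin.last (0 + 1)) = w) ∧ f 1 = b } :=
      ⟨fun ⟨f, ⟨_, _, _, hl⟩, h1⟩ => hw (h1.symm.trans hl)⟩
    exact Nat.card_of_isEmpty

theorem nbWalkCountFrom_succ (G : SimpleGraph V) (k : ℕ) {a b : V} (w : V) (h : G.Adj a b) :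
    nbWalkCountFrom G (k + 1) a b w =
      Nat.card { g : Fin (k + 2) → V // (IsWalkFun G (k + 1) g ∧ IsNonBacktracking (k + 1) g ∧
        g 0 = b ∧ g (Fin.last (k + 1)) = w) ∧ ¬ g 1 = a } := by
  symm
  refine Nat.card_congr (Equiv.ofBijective (fun g => ⟨Fin.cons a g.1, ?_⟩) ⟨?_, ?_⟩)
  · obtain ⟨g, ⟨hg, hn, h0, hl⟩, h1⟩ := g
    exact ⟨⟨(isWalkFun_cons ..).2 ⟨h0 ▸ h, hg⟩,
      (isNonBacktracking_cons ..).2 ⟨h1, hn⟩, rfl, hl⟩, h0⟩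
  · intro g g' hgg
    exact Subtype.ext (Fin.cons_right_injective (α := fun _ => V) a (congrArg Subtype.val hgg))
  · rintro ⟨f, ⟨hf, hn, h0, hl⟩, h1⟩
    have hfc : f = (Fin.cons a (Fin.tail f) : Fin (k + 3) → V) := by
      rw [← h0, Fin.cons_self_tail]
    rw [hfc] at hf hn
    exact ⟨⟨Fin.tail f, ⟨((isWalkFun_cons ..).1 hf).2,
      ((isNonBacktracking_cons ..).1 hn).2, h1, hl⟩,
      ((isNonBacktracking_cons ..).1 hn).1⟩, Subtype.ext hfc.symm⟩

theorem nbWalkCountFrom_succ_add (G : SimpleGraph V) [Fintype V] (k : ℕ) {a b : V} (w : V)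
    (h : G.Adj a b) :
    (nbWalkCountFrom G (k + 1) a b w : ℝ) + nbWalkCountFrom G k b a w =
      nbWalkMatrixR G (k + 1) b w := by
  classical
  rw [nbWalkCountFrom_succ G k w h, nbWalkCountFrom, nbWalkMatrixR, Matrix.of_apply]
  simp only [Nat.card_eq_fintype_card, Fintype.card_subtype, ← Finset.filter_filter]
  rw [add_comm, ← Nat.cast_add, Finset.card_filter_add_card_filter_not]

theorem nbWalkMatrixR_succ_apply_eq_sum_neighborFinset (G : SimpleGraph V) [Fintype V]
    [DecidableRel G.Adj] (k : ℕ) (a w : V) :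
    nbWalkMatrixR G (k + 1) a w = ∑ b ∈ G.neighborFinset a, (nbWalkCountFrom G k a b w : ℝ) := by
  rw [nbWalkMatrixR_succ_apply]
  refine (Finset.sum_subset (Finset.subset_univ _) fun b _ hb => ?_).symm
  rw [nbWalkCountFrom_of_not_adj G k w (by simpa using hb), Nat.cast_zero]

theorem nbWalkMatrixR_one (G : SimpleGraph V) [Fintype V] [DecidableEq V] [DecidableRel G.Adj] :
    nbWalkMatrixR G 1 = G.adjMatrix ℝ := by
  ext a w
  rw [nbWalkMatrixR_succ_apply_eq_sum_neighborFinset G 0,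
    Finset.sum_congr rfl fun b hb => by
      rw [nbWalkCountFrom_zero G w (by simpa using hb)]]
  simp [SimpleGraph.adjMatrix_apply]

theorem nbWalkMatrixR_add_two_apply (G : SimpleGraph V) [Fintype V] [DecidableRel G.Adj]
    (k : ℕ) (a w : V) :
    nbWalkMatrixR G (k + 2) a w = (G.adjMatrix ℝ * nbWalkMatrixR G (k + 1)) a w -
      ∑ b ∈ G.neighborFinset a, (nbWalkCountFrom G k b a w : ℝ) := by
  rw [nbWalkMatrixR_succ_apply_eq_sum_neighborFinset G (k + 1), SimpleGraph.adjMatrix_mul_apply,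
    ← Finset.sum_sub_distrib]
  refine Finset.sum_congr rfl fun b hb => ?_
  rw [← nbWalkCountFrom_succ_add G k w (by simpa using hb), add_sub_cancel_right]

theorem nbWalkMatrixR_two (G : SimpleGraph V) [Fintype V] [DecidableEq V] [DecidableRel G.Adj]
    {d : ℕ} (hreg : G.IsRegularOfDegree d) :
    nbWalkMatrixR G 2 = G.adjMatrix ℝ * G.adjMatrix ℝ - (d : ℝ) • 1 := by
  ext a w
  rw [nbWalkMatrixR_add_two_apply G 0, zero_add, nbWalkMatrixR_one,
    Finset.sum_congr rfl fun b hb => by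
      rw [nbWalkCountFrom_zero G w (G.adj_symm (by simpa using hb))]]
  simp [Matrix.one_apply, hreg.degree_eq a]

theorem nbWalkMatrixR_add_three (G : SimpleGraph V) [Fintype V] [DecidableRel G.Adj]
    {d : ℕ} (hreg : G.IsRegularOfDegree d) (k : ℕ) :
    nbWalkMatrixR G (k + 3) = G.adjMatrix ℝ * nbWalkMatrixR G (k + 2) -
      ((d : ℝ) - 1) • nbWalkMatrixR G (k + 1) := by
  ext a w
  rw [nbWalkMatrixR_add_two_apply G (k + 1), Matrix.sub_apply, Matrix.smul_apply, smul_eq_mul]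
  congr 1
  rw [Finset.sum_congr rfl fun b hb => eq_sub_of_add_eq
      (nbWalkCountFrom_succ_add G k w (G.adj_symm (by simpa using hb))),
    Finset.sum_sub_distrib, ← nbWalkMatrixR_succ_apply_eq_sum_neighborFinset, Finset.sum_const,
    SimpleGraph.card_neighborFinset_eq_degree, hreg.degree_eq a, nsmul_eq_mul]
  ring

open Polynomial in
theorem pow_smul_aeval_chebyshevU_add_two {R : Type*} [Ring R] [Algebra ℝ R] {s : ℝ} (hs : s ≠ 0)
    (x : R) (k : ℕ) :
    s ^ (k + 2) • aeval ((2 * s)⁻¹ • x) (Chebyshev.U ℝ ((k : ℤ) + 2)) =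
      x * (s ^ (k + 1) • aeval ((2 * s)⁻¹ • x) (Chebyshev.U ℝ ((k : ℤ) + 1))) -
        s ^ 2 • (s ^ k • aeval ((2 * s)⁻¹ • x) (Chebyshev.U ℝ (k : ℤ))) := by
  have h2 : (2 : R) = algebraMap ℝ R 2 := (map_ofNat _ 2).symm
  rw [Chebyshev.U_add_two]
  rw [map_sub, map_mul, map_mul, aeval_X, map_ofNat, h2, ← Algebra.smul_def]
  simp only [smul_sub, mul_smul_comm, smul_mul_assoc, smul_smul]
  congr 2
  · field_simp
    ring
  · ring

open Polynomial in
theorem nbWalkMatrix_eq_chebyshevU_diff (G : SimpleGraph V) [Fintype V] [DecidableEq V]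
    [DecidableRel G.Adj] (d : ℕ) (hd : 2 ≤ d) (hreg : G.IsRegularOfDegree d)
    (k : ℕ) (hk : 2 ≤ k) :
    nbWalkMatrixR G k =
      (Real.sqrt ((d : ℝ) - 1)) ^ k •
        Polynomial.aeval ((2 * Real.sqrt ((d : ℝ) - 1))⁻¹ • G.adjMatrix ℝ)
          (Polynomial.Chebyshev.U ℝ (k : ℤ)) -
      (Real.sqrt ((d : ℝ) - 1)) ^ (k - 2) •
        Polynomial.aeval ((2 * Real.sqrt ((d : ℝ) - 1))⁻¹ • G.adjMatrix ℝ)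
          (Polynomial.Chebyshev.U ℝ ((k : ℤ) - 2)) := by
  have hd' : (2 : ℝ) ≤ d := by exact_mod_cast hd
  have hs : Real.sqrt ((d : ℝ) - 1) ≠ 0 := (Real.sqrt_pos.2 (by linarith)).ne'
  have hsq : Real.sqrt ((d : ℝ) - 1) ^ 2 = (d : ℝ) - 1 := Real.sq_sqrt (by linarith)
  set s := Real.sqrt ((d : ℝ) - 1)
  obtain ⟨p, hp⟩ : ∃ p : ℕ → Matrix V V ℝ, ∀ j : ℕ,
      p j = s ^ j • aeval ((2 * s)⁻¹ • G.adjMatrix ℝ) (Chebyshev.U ℝ (j : ℤ)) := ⟨_, fun _ => rfl⟩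
  have hrec (j : ℕ) : p (j + 2) = G.adjMatrix ℝ * p (j + 1) - ((d : ℝ) - 1) • p j := by
    rw [hp, hp, hp, ← hsq]
    exact_mod_cast pow_smul_aeval_chebyshevU_add_two hs (G.adjMatrix ℝ) j
  have hp0 : p 0 = 1 := by simp [hp]
  have hp1 : p 1 = G.adjMatrix ℝ := by
    have h2 : (2 : Matrix V V ℝ) = algebraMap ℝ _ 2 := (map_ofNat _ 2).symm
    rw [hp, Nat.cast_one, Chebyshev.U_one, map_mul, map_ofNat, aeval_X, h2, ← Algebra.smul_def,
      smul_smul, smul_smul]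
    convert one_smul ℝ _
    field_simp
  have hp2 : nbWalkMatrixR G 2 = p 2 - p 0 := by
    rw [nbWalkMatrixR_two G hreg, hrec, zero_add, hp1, hp0, sub_smul, one_smul]
    abel
  have key (j : ℕ) : nbWalkMatrixR G (j + 2) = p (j + 2) - p j := by
    induction j using Nat.twoStepInduction with
    | zero => exact hp2
    | one =>
      rw [nbWalkMatrixR_add_three G hreg 0, zero_add, zero_add, hp2, nbWalkMatrixR_one, hrec 1,
        hp0, hp1, mul_sub, mul_one]
      abel
    | more j ih1 ih2 =>
      rw [nbWalkMatrixR_add_three G hreg (j + 1), ih1, ih2, hrec (j + 2), hrec j, mul_sub, smul_sub]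
      abel
  obtain ⟨j, rfl⟩ := Nat.exists_eq_add_of_le' hk
  rw [key, hp, hp, Nat.add_sub_cancel]
  push_cast
  rw [add_sub_cancel_right]
end

section
/- Let d ≥ 2 and let G be a finite simple d-regular graph with n vertices and adjacency matrix A, regarded as a real matrix. In ℝ⟦t⟧, the matrix I − At + (d−1)t²·I over ℝ⟦t⟧ is invertible (its constant term is the identity), and Σ_{k≥1} N_k t^k = n(d−2)·t²·(1 − t²)^{−1} + Tr( (At − 2(d−1)t²·I) · ( I − At + (d−1)t²·I )^{−1} ). -/
variable {V : Type*}

open PowerSeries in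
/-- The geometric series of a matrix `M` inverts `1 - X M` over power series. -/
theorem geomSeries_mul_one_sub_X_smul {ι R : Type*} [Fintype ι] [DecidableEq ι] [CommRing R]
    (M : Matrix ι ι R) :
    (Matrix.of fun i j => PowerSeries.mk fun k => (M ^ k) i j) *
      (1 - (X : PowerSeries R) • M.map (C (R := R))) = 1 := by
  rw [mul_sub, mul_one, Matrix.mul_smul]
  ext i j n
  rcases n with _ | n
  · by_cases h : i = j <;> simp [Matrix.one_apply, h]
  · have h1 : coeff (n + 1) ((1 : Matrix ι ι (PowerSeries R)) i j) = 0 := by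
      by_cases h : i = j <;> simp [Matrix.one_apply, h, coeff_one]
    rw [h1, Matrix.sub_apply, Matrix.smul_apply, smul_eq_mul, map_sub, coeff_succ_X_mul,
      Matrix.mul_apply, map_sum]
    simp [pow_succ, Matrix.mul_apply]

/-- Powers of the `0`-`1` matrix of a relation count chains of that relation. -/
theorem of_ite_pow_apply_eq_card_chains {ι R : Type*} [Fintype ι] [DecidableEq ι] [CommSemiring R]
    (r : ι → ι → Prop) [DecidableRel r] (k : ℕ) (a b : ι) :
    ((Matrix.of fun i j => if r i j then (1 : R) else 0) ^ k) a b =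
      (Nat.card {f : Fin (k + 1) → ι //
        f 0 = a ∧ f (Fin.last k) = b ∧ ∀ i : Fin k, r (f i.castSucc) (f i.succ)} : R) := by
  induction k generalizing a with
  | zero =>
    rw [pow_zero, Matrix.one_apply]
    by_cases h : a = b
    · subst h
      have : Unique {f : Fin (0 + 1) → ι //
          f 0 = a ∧ f (Fin.last 0) = a ∧ ∀ i : Fin 0, r (f i.castSucc) (f i.succ)} :=
        { default := ⟨fun _ => a, rfl, rfl, fun i => i.elim0⟩
          uniq := fun f => by
            apply Subtype.ext
            funext i
            rw [Fin.fin_one_eq_zero i]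
            exact f.2.1 }
      rw [Nat.card_unique, if_pos rfl, Nat.cast_one]
    · have : IsEmpty {f : Fin (0 + 1) → ι //
          f 0 = a ∧ f (Fin.last 0) = b ∧ ∀ i : Fin 0, r (f i.castSucc) (f i.succ)} :=
        ⟨fun f => h (f.2.1.symm.trans f.2.2.1)⟩
      rw [Nat.card_of_isEmpty, if_neg h, Nat.cast_zero]
  | succ k ih =>
    have e : {f : Fin (k + 1 + 1) → ι //
        f 0 = a ∧ f (Fin.last (k + 1)) = b ∧ ∀ i : Fin (k + 1), r (f i.castSucc) (f i.succ)} ≃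
        Σ c : {c : ι // r a c}, {f : Fin (k + 1) → ι //
          f 0 = c ∧ f (Fin.last k) = b ∧ ∀ i : Fin k, r (f i.castSucc) (f i.succ)} :=
      { toFun := fun f => ⟨⟨f.1 1, f.2.1.subst (motive := fun x => r x (f.1 1)) (f.2.2.2 0)⟩,
          ⟨fun i => f.1 i.succ, rfl, f.2.2.1, fun i => f.2.2.2 i.succ⟩⟩
        invFun := fun p => ⟨Fin.cons a p.2.1, rfl, p.2.2.2.1, fun i => by
          refine Fin.cases ?_ (fun i => ?_) i
          · have h := p.1.2
            rw [← p.2.2.1] at h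
            exact h
          · exact p.2.2.2.2 i⟩
        left_inv := fun f => by
          apply Subtype.ext
          funext i
          refine Fin.cases ?_ (fun i => ?_) i
          · exact f.2.1.symm
          · rfl
        right_inv := fun p => by
          obtain ⟨⟨c, hc⟩, ⟨f, hf, hf'⟩⟩ := p
          dsimp only at hf
          subst hf
          rfl }
    rw [Nat.card_congr e, Nat.card_sigma, pow_succ', Matrix.mul_apply, Nat.cast_sum]
    simp only [ih, Matrix.of_apply, ite_mul, one_mul, zero_mul]
    rw [← Finset.sum_filter, ← Finset.sum_subtype_eq_sum_filter]
    exact Finset.sum_congr (by ext; simp) fun _ _ => rfl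

namespace SimpleGraph

/-- A dart may be followed by another one in a non-backtracking walk. -/
def NBStep (G : SimpleGraph V) (e e' : G.Dart) : Prop :=
  e.snd = e'.fst ∧ e.fst ≠ e'.snd

instance [DecidableEq V] (G : SimpleGraph V) : DecidableRel G.NBStep :=
  fun _ _ => inferInstanceAs (Decidable (_ ∧ _))

variable (G : SimpleGraph V)

/-- Closed chains of darts are the same as rooted non-backtracking cycles. -/
theorem card_closed_dart_chains_eq_nbCycleCount {k : ℕ} (hk : 0 < k) :
    Nat.card {D : Fin (k + 1) → G.Dart //
      D 0 = D (Fin.last k) ∧ ∀ i : Fin k, G.NBStep (D i.castSucc) (D i.succ)} =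
      nbCycleCount G k := by
  have hfst (D : Fin (k + 1) → G.Dart) (h : ∀ i : Fin k, G.NBStep (D i.castSucc) (D i.succ))
      (i : ℕ) (hi : i < k) : (D ⟨i, by omega⟩).snd = (D ⟨i + 1, by omega⟩).fst := (h ⟨i, hi⟩).1
  have hne (D : Fin (k + 1) → G.Dart) (h : ∀ i : Fin k, G.NBStep (D i.castSucc) (D i.succ))
      (i : ℕ) (hi : i < k) : (D ⟨i, by omega⟩).fst ≠ (D ⟨i + 1, by omega⟩).snd := (h ⟨i, hi⟩).2
  have h1 : (⟨1 % (k + 1), Nat.mod_lt 1 k.succ_pos⟩ : Fin (k + 1)) = ⟨1, by omega⟩ :=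
    Fin.ext (Nat.mod_eq_of_lt (by omega))
  refine Nat.card_eq_of_bijective (fun D => ⟨fun i => (D.1 i).fst, ⟨?_, ?_, ?_⟩, ?_⟩) ⟨?_, ?_⟩
  · intro i hi
    dsimp only
    rw [← hfst D.1 D.2.2 i hi]
    exact (D.1 _).adj
  · intro i hi hik
    obtain ⟨i, rfl⟩ := Nat.exists_eq_add_of_le' hi
    have := hne D.1 D.2.2 i (by omega)
    rw [hfst D.1 D.2.2 (i + 1) hik] at this
    exact this
  · exact congrArg (·.fst) D.2.1.symm
  · obtain ⟨k, rfl⟩ := Nat.exists_eq_add_of_le' hk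
    have h := hne D.1 D.2.2 k (by omega)
    have hl : (D.1 ⟨k + 1, by omega⟩).snd = (D.1 ⟨1, by omega⟩).fst := by
      rw [← hfst D.1 D.2.2 0 (by omega)]
      exact congrArg (·.snd) D.2.1.symm
    rw [hl] at h
    rw [h1]
    exact h.symm
  · rintro ⟨D, hD, hs⟩ ⟨D', hD', hs'⟩ h
    have hf : ∀ i, (D i).fst = (D' i).fst := fun i => congrFun (congrArg Subtype.val h) i
    have hlt : ∀ i (hi : i < k), D ⟨i, by omega⟩ = D' ⟨i, by omega⟩ := fun i hi => by
      apply Dart.ext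
      apply Prod.ext
      · exact hf _
      · have := hf ⟨i + 1, by omega⟩
        rw [← hfst D hs i hi, ← hfst D' hs' i hi] at this
        exact this
    apply Subtype.ext
    funext i
    rcases Nat.lt_or_ge i.1 k with hi | hi
    · exact hlt i.1 hi
    · have : i = Fin.last k := Fin.ext (by simp; omega)
      subst this
      have h0 := hlt 0 hk
      exact hD.symm.trans (h0.trans hD')
  · rintro ⟨f, ⟨hw, hnb, hc⟩, ht⟩
    rw [h1] at ht
    let w : ℕ → V := fun i => if h : i ≤ k then f ⟨i, by omega⟩ else f ⟨1, by omega⟩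
    have hle (i : ℕ) (h : i ≤ k) : w i = f ⟨i, by omega⟩ := dif_pos h
    have hwl : w (k + 1) = f ⟨1, by omega⟩ := dif_neg (by omega)
    have hk0 : w k = f 0 := (hle k le_rfl).trans hc
    have hadj : ∀ i, i ≤ k → G.Adj (w i) (w (i + 1)) := by
      intro i hi
      rcases hi.lt_or_eq with h | rfl
      · rw [hle i hi, hle (i + 1) h]
        exact hw i h
      · rw [hk0, hwl]
        exact hw 0 hk
    have hdist : ∀ i, i < k → w i ≠ w (i + 1 + 1) := by
      intro i hi
      rcases (Nat.succ_le_of_lt hi).lt_or_eq with h | rfl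
      · rw [hle i hi.le, hle (i + 1 + 1) h]
        exact hnb (i + 1) (by omega) h
      · rw [hwl, hle i hi.le]
        exact ht.symm
    refine ⟨⟨fun i => ⟨(w i, w (i + 1)), hadj i (by omega)⟩, ?_, ?_⟩, ?_⟩
    · apply Dart.ext
      apply Prod.ext
      · exact (hle 0 hk.le).trans hk0.symm
      · exact (hle 1 hk).trans hwl.symm
    · exact fun i => ⟨rfl, hdist i i.2⟩
    · apply Subtype.ext
      funext i
      exact hle i (by omega)

theorem sum_darts [Fintype V] [DecidableRel G.Adj] {M : Type*} [AddCommMonoid M] (f : V → V → M) :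
    ∑ e : G.Dart, f e.fst e.snd = ∑ u, ∑ v, if G.Adj u v then f u v else 0 := by
  rw [← Fintype.sum_prod_type' (f := fun u v => if G.Adj u v then f u v else 0),
    ← Finset.sum_filter]
  refine Finset.sum_bij (fun e _ => e.toProd) (fun e _ => by simp [e.adj])
    (fun _ _ _ _ h => Dart.ext _ _ h) (fun p hp => ?_) (fun _ _ => rfl)
  exact ⟨⟨p, (Finset.mem_filter.1 hp).2⟩, Finset.mem_univ _, rfl⟩

theorem card_dart_of_isRegularOfDegree [Fintype V] [DecidableRel G.Adj] {d : ℕ} (hreg : G.IsRegularOfDegree d) :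
    Fintype.card G.Dart = Fintype.card V * d := by
  rw [dart_card_eq_sum_degrees, Finset.sum_congr rfl fun v _ => hreg v]
  simp

variable [DecidableEq V]

/-- Hashimoto's non-backtracking matrix. -/
def nbMatrix (R : Type*) [Zero R] [One R] : Matrix G.Dart G.Dart R :=
  Matrix.of fun e e' => if G.NBStep e e' then 1 else 0

/-- The incidence matrix between vertices and the darts leaving them. -/
def startMatrix (R : Type*) [Zero R] [One R] : Matrix V G.Dart R :=
  Matrix.of fun v e => if v = e.fst then 1 else 0

/-- The incidence matrix between darts and their final vertices. -/
def endMatrix (R : Type*) [Zero R] [One R] : Matrix G.Dart V R :=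
  Matrix.of fun e v => if e.snd = v then 1 else 0

/-- The permutation matrix of dart reversal. -/
def reversalMatrix (R : Type*) [Zero R] [One R] : Matrix G.Dart G.Dart R :=
  Matrix.of fun e e' => if e.symm = e' then 1 else 0

theorem map_C_nbMatrix :
    (G.nbMatrix ℝ).map (PowerSeries.C (R := ℝ)) = G.nbMatrix (PowerSeries ℝ) := by
  ext1 e e'
  by_cases h : G.NBStep e e' <;> simp [nbMatrix, h]

theorem endMatrix_mul_startMatrix [Fintype V] (R : Type*) [CommRing R] :
    G.endMatrix R * G.startMatrix R = G.nbMatrix R + G.reversalMatrix R := by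
  ext e e'
  have h : e.symm = e' ↔ e.snd = e'.fst ∧ e.fst = e'.snd := by
    rw [Dart.ext_iff, Prod.ext_iff]
    rfl
  by_cases h1 : e.snd = e'.fst <;> by_cases h2 : e.fst = e'.snd <;>
    simp [endMatrix, startMatrix, nbMatrix, reversalMatrix, NBStep, Matrix.mul_apply, h, h1, h2]

variable [Fintype V] [DecidableRel G.Adj]

theorem trace_nbMatrix_pow {R : Type*} [CommSemiring R] {k : ℕ} (hk : 0 < k) :
    (G.nbMatrix R ^ k).trace = nbCycleCount G k := by
  have e : (Σ a : G.Dart, {D : Fin (k + 1) → G.Dart //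
      D 0 = a ∧ D (Fin.last k) = a ∧ ∀ i : Fin k, G.NBStep (D i.castSucc) (D i.succ)}) ≃
      {D : Fin (k + 1) → G.Dart //
        D 0 = D (Fin.last k) ∧ ∀ i : Fin k, G.NBStep (D i.castSucc) (D i.succ)} :=
    { toFun := fun p => ⟨p.2.1, p.2.2.1.trans p.2.2.2.1.symm, p.2.2.2.2⟩
      invFun := fun D => ⟨D.1 0, D.1, rfl, D.2.1.symm, D.2.2⟩
      left_inv := by
        rintro ⟨a, D, rfl, h⟩
        rfl
      right_inv := fun _ => rfl }
  rw [← card_closed_dart_chains_eq_nbCycleCount G hk, ← Nat.card_congr e, Nat.card_sigma,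
    Nat.cast_sum]
  exact Finset.sum_congr rfl fun a _ => of_ite_pow_apply_eq_card_chains _ k a a

section Identities

variable (R : Type*) [CommRing R]

theorem reversalMatrix_mul_self : G.reversalMatrix R * G.reversalMatrix R = 1 := by
  ext e e'
  simp only [reversalMatrix, Matrix.mul_apply, Matrix.one_apply, Matrix.of_apply, ite_mul, one_mul,
    zero_mul, Finset.sum_ite_eq, Finset.mem_univ, if_true, Dart.symm_symm]

theorem startMatrix_mul_endMatrix : G.startMatrix R * G.endMatrix R = G.adjMatrix R := by
  ext u v
  simp only [Matrix.mul_apply, startMatrix, endMatrix, Matrix.of_apply, adjMatrix_apply]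
  rw [G.sum_darts fun a b => (if u = a then (1 : R) else 0) * if b = v then 1 else 0]
  rw [Finset.sum_eq_single u, Finset.sum_eq_single v] <;> simp +contextual [eq_comm]

theorem startMatrix_mul_reversalMatrix_mul_endMatrix {d : ℕ} (hreg : G.IsRegularOfDegree d) :
    G.startMatrix R * G.reversalMatrix R * G.endMatrix R = (d : R) • 1 := by
  ext u v
  rw [Matrix.mul_assoc]
  simp only [Matrix.mul_apply, startMatrix, endMatrix, reversalMatrix,
    Matrix.of_apply, ite_mul, one_mul, zero_mul, Finset.sum_ite_eq, Finset.mem_univ, if_true]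
  have := G.sum_darts fun a _ => if u = a then (if a = v then (1 : R) else 0) else 0
  refine Eq.trans this ?_
  rw [Finset.sum_eq_single u]
  · have hdeg : ∑ w, (if G.Adj u w then (1 : R) else 0) = d := by
      rw [← hreg u, Finset.sum_boole, ← card_neighborFinset_eq_degree, neighborFinset_eq_filter]
    by_cases h : u = v
    · subst h
      simpa using hdeg
    · simp [h]
  · intro b _ hb
    simp [hb.symm]
  · simp

theorem trace_reversalMatrix : (G.reversalMatrix R).trace = 0 := by
  simp [Matrix.trace, reversalMatrix, Dart.symm_ne]

/-- A Woodbury identity for `1 - t B`, with `B` the non-backtracking matrix. -/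
theorem one_sub_smul_nbMatrix_mul {d : ℕ} (hreg : G.IsRegularOfDegree d) (t : R)
    (P : Matrix V V R)
    (hP : (1 - t • G.adjMatrix R + (((d : R) - 1) * t ^ 2) • (1 : Matrix V V R)) * P = 1) :
    (1 - t • G.nbMatrix R) * ((1 - t • G.reversalMatrix R) +
      t • ((1 - t • G.reversalMatrix R) * G.endMatrix R * P * G.startMatrix R *
        (1 - t • G.reversalMatrix R))) = (1 - t ^ 2) • 1 := by
  have hJ := G.reversalMatrix_mul_self R
  have hB : G.nbMatrix R = G.endMatrix R * G.startMatrix R - G.reversalMatrix R := by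
    rw [endMatrix_mul_startMatrix, add_sub_cancel_right]
  have hST := G.startMatrix_mul_endMatrix R
  have hSJT := G.startMatrix_mul_reversalMatrix_mul_endMatrix R hreg
  rw [hB]
  set J := G.reversalMatrix R
  set S := G.startMatrix R
  set T := G.endMatrix R
  set L := 1 - t • J with hL
  have hKL : (1 + t • J) * L = (1 - t ^ 2) • 1 := by
    simp only [hL, add_mul, mul_sub, one_mul, mul_one, Matrix.smul_mul, Matrix.mul_smul, hJ]
    module
  have hSLT : S * L * T = G.adjMatrix R - (t * d) • 1 := by
    simp only [hL, Matrix.mul_sub, Matrix.sub_mul, Matrix.mul_one,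
      Matrix.smul_mul, Matrix.mul_smul, hST, hSJT]
    module
  have hPQ : (1 - t ^ 2) • P - t • ((G.adjMatrix R - (t * d) • 1) * P) = 1 := by
    refine Eq.trans ?_ hP
    simp only [add_mul, sub_mul, one_mul, Matrix.smul_mul]
    module
  calc (1 - t • (T * S - J)) * (L + t • (L * T * P * S * L))
      = (1 + t • J) * L - t • (T * S * L) + t • (((1 + t • J) * L) * T * P * S * L)
        - (t * t) • (T * (S * L * T * P) * S * L) := by
        simp only [Matrix.mul_add, Matrix.add_mul, Matrix.sub_mul, Matrix.smul_mul,
          Matrix.mul_smul, Matrix.mul_assoc, Matrix.one_mul, smul_sub]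
        module
    _ = (1 - t ^ 2) • 1 + t • (T * ((1 - t ^ 2) • P - t • ((G.adjMatrix R - (t * d) • 1) * P) - 1)
          * S * L) := by
        rw [hKL, hSLT]
        simp only [Matrix.mul_sub, Matrix.sub_mul, Matrix.smul_mul,
          Matrix.mul_smul, Matrix.mul_assoc, Matrix.one_mul]
        module
    _ = _ := by rw [hPQ]; simp

/-- The trace of the matrix `(1 - t ^ 2) (1 - t B)⁻¹`, with `B` the non-backtracking matrix. -/
theorem trace_nb_resolvent {d : ℕ} (hreg : G.IsRegularOfDegree d) (t : R)
    (P : Matrix V V R) :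
    ((1 - t • G.reversalMatrix R) +
      t • ((1 - t • G.reversalMatrix R) * G.endMatrix R * P * G.startMatrix R *
        (1 - t • G.reversalMatrix R))).trace =
      Fintype.card V * d + t * ((1 + t ^ 2) * (G.adjMatrix R * P).trace - 2 * t * d * P.trace) := by
  have hJ := G.reversalMatrix_mul_self R
  have hST := G.startMatrix_mul_endMatrix R
  have hSJT := G.startMatrix_mul_reversalMatrix_mul_endMatrix R hreg
  have hcard := G.card_dart_of_isRegularOfDegree hreg
  have htr := G.trace_reversalMatrix R
  set J := G.reversalMatrix R
  set S := G.startMatrix R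
  set T := G.endMatrix R
  have hLL : (1 - t • J) * (1 - t • J) = (1 + t ^ 2) • 1 - (2 * t) • J := by
    simp only [mul_sub, sub_mul, one_mul, mul_one, Matrix.smul_mul, Matrix.mul_smul, hJ]
    module
  have hcyc : ((1 - t • J) * T * P * S * (1 - t • J)).trace =
      (S * ((1 - t • J) * (1 - t • J)) * T * P).trace := by
    rw [Matrix.mul_assoc ((1 - t • J) * T * P), Matrix.trace_mul_comm]
    simp only [Matrix.mul_assoc]
  rw [Matrix.trace_add, Matrix.trace_smul, hcyc, hLL]
  simp only [Matrix.mul_sub, Matrix.sub_mul, Matrix.mul_smul, Matrix.smul_mul, Matrix.mul_one,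
    Matrix.one_mul, hST, hSJT, Matrix.trace_sub, Matrix.trace_smul, htr, Matrix.trace_one, hcard,
    smul_eq_mul]
  push_cast
  ring

end Identities

open PowerSeries in
theorem isUnit_one_sub_X_smul_adjMatrix_add (c : PowerSeries ℝ) :
    IsUnit ((1 : Matrix V V (PowerSeries ℝ)) - (X : PowerSeries ℝ) • G.adjMatrix (PowerSeries ℝ)
      + (c * X ^ 2) • (1 : Matrix V V (PowerSeries ℝ))) := by
  have h : (constantCoeff (R := ℝ)).mapMatrix ((1 : Matrix V V (PowerSeries ℝ))
      - (X : PowerSeries ℝ) • G.adjMatrix (PowerSeries ℝ)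
      + (c * X ^ 2) • (1 : Matrix V V (PowerSeries ℝ))) = 1 := by
    ext i j
    by_cases h : i = j <;> by_cases h' : G.Adj i j <;> simp [Matrix.one_apply, h, h']
  rw [Matrix.isUnit_iff_isUnit_det, PowerSeries.isUnit_iff_constantCoeff, RingHom.map_det, h,
    Matrix.det_one]
  exact isUnit_one

theorem mk_trace_nbMatrix_pow {d : ℕ} (hreg : G.IsRegularOfDegree d) :
    (PowerSeries.mk fun k => (G.nbMatrix ℝ ^ k).trace) =
      (Fintype.card V : PowerSeries ℝ) * d +
        PowerSeries.mk fun k => if k = 0 then (0 : ℝ) else (nbCycleCount G k : ℝ) := by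
  have hc : (Fintype.card V : PowerSeries ℝ) * d =
      PowerSeries.C ((Fintype.card V : ℝ) * d) := by simp
  ext k
  rw [hc]
  rcases Nat.eq_zero_or_pos k with rfl | hk
  · simp [G.card_dart_of_isRegularOfDegree hreg]
  · rw [map_add, PowerSeries.coeff_C, if_neg hk.ne', zero_add, PowerSeries.coeff_mk,
      PowerSeries.coeff_mk, if_neg hk.ne', G.trace_nbMatrix_pow hk]

end SimpleGraph

theorem nbCycleCount_generating_function (G : SimpleGraph V) [Fintype V] [DecidableEq V]
    [DecidableRel G.Adj] (d : ℕ) (hd : 2 ≤ d) (hreg : G.IsRegularOfDegree d) :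
    IsUnit ((1 : Matrix V V (PowerSeries ℝ))
        - (PowerSeries.X : PowerSeries ℝ) • G.adjMatrix (PowerSeries ℝ)
        + (((d : PowerSeries ℝ) - 1) * PowerSeries.X ^ 2) • (1 : Matrix V V (PowerSeries ℝ))) ∧
    (PowerSeries.mk fun k => if k = 0 then (0 : ℝ) else (nbCycleCount G k : ℝ)) =
      (Fintype.card V : PowerSeries ℝ) * ((d : PowerSeries ℝ) - 2) * PowerSeries.X ^ 2 *
          ((1 : PowerSeries ℝ) - PowerSeries.X ^ 2)⁻¹ +
        Matrix.trace
          (((PowerSeries.X : PowerSeries ℝ) • G.adjMatrix (PowerSeries ℝ)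
              - (2 * ((d : PowerSeries ℝ) - 1) * PowerSeries.X ^ 2) • (1 : Matrix V V (PowerSeries ℝ))) *
            ((1 : Matrix V V (PowerSeries ℝ))
              - (PowerSeries.X : PowerSeries ℝ) • G.adjMatrix (PowerSeries ℝ)
              + (((d : PowerSeries ℝ) - 1) * PowerSeries.X ^ 2) • (1 : Matrix V V (PowerSeries ℝ)))⁻¹) := by
  have hU := G.isUnit_one_sub_X_smul_adjMatrix_add ((d : PowerSeries ℝ) - 1)
  refine ⟨hU, ?_⟩
  rw [Matrix.isUnit_iff_isUnit_det] at hU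
  have hQP := Matrix.mul_nonsing_inv _ hU
  set Q := (1 : Matrix V V (PowerSeries ℝ))
    - (PowerSeries.X : PowerSeries ℝ) • G.adjMatrix (PowerSeries ℝ)
    + (((d : PowerSeries ℝ) - 1) * PowerSeries.X ^ 2) • (1 : Matrix V V (PowerSeries ℝ)) with hQ
  set P := Q⁻¹
  set t : PowerSeries ℝ := PowerSeries.X
  have hres := G.one_sub_smul_nbMatrix_mul _ hreg t P hQP
  have htr := G.trace_nb_resolvent _ hreg t P
  have hgeom := geomSeries_mul_one_sub_X_smul (G.nbMatrix ℝ)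
  rw [G.map_C_nbMatrix] at hgeom
  have hmk : (Matrix.of fun i j => PowerSeries.mk fun k => (G.nbMatrix ℝ ^ k) i j).trace =
      PowerSeries.mk fun k => (G.nbMatrix ℝ ^ k).trace := by
    ext k
    simp [Matrix.trace]
  have hmul := congrArg
    ((Matrix.of fun i j => PowerSeries.mk fun k => (G.nbMatrix ℝ ^ k) i j) * ·) hres
  simp only [← Matrix.mul_assoc _ (1 - t • G.nbMatrix (PowerSeries ℝ))] at hmul
  rw [hgeom, Matrix.one_mul] at hmul
  rw [hmul, Matrix.mul_smul, Matrix.mul_one, Matrix.trace_smul, hmk, G.mk_trace_nbMatrix_pow hreg,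
    smul_eq_mul] at htr
  have hone : (Fintype.card V : PowerSeries ℝ) =
      P.trace - t * (G.adjMatrix (PowerSeries ℝ) * P).trace
        + ((d : PowerSeries ℝ) - 1) * t ^ 2 * P.trace := by
    rw [← Matrix.trace_one, ← hQP, hQ]
    simp only [Matrix.add_mul, Matrix.sub_mul, Matrix.one_mul, Matrix.smul_mul, Matrix.trace_add,
      Matrix.trace_sub, Matrix.trace_smul, smul_eq_mul]
  have hinv : (1 - t ^ 2) * (1 - t ^ 2)⁻¹ = 1 := PowerSeries.mul_inv_cancel _ (by simp [t])
  simp only [Matrix.sub_mul, Matrix.one_mul, Matrix.smul_mul, Matrix.trace_sub, Matrix.trace_smul,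
    smul_eq_mul]
  refine (IsUnit.of_mul_eq_one _ hinv).mul_left_cancel ?_
  linear_combination htr + 2 * t ^ 2 * hone
    - (Fintype.card V : PowerSeries ℝ) * ((d : PowerSeries ℝ) - 2) * t ^ 2 * hinv
end
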